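/- arXiv:1105.2721 — 2 statements merged into one kernel-verified Lean document; each statement's English description precedes it below -/
import Mathlib

section
/- Let {B_s : 0 < s ≤ s_0} be a scale of Banach spaces and suppose that for every pair s', s'' with 0 < s' < s'' ≤ s_0 the linear mapping A : B_{s''} → B_{s'} satisfies ‖A u‖_{s'} ≤ M/(s'' − s') · ‖u‖_{s''} for all u ∈ B_{s''}, where M > 0 is independent of s', s'' and u. Then for every s ∈ (0, s_0), every m ∈ ℕ and every u_0 ∈ B_{s_0}, the m-fold composition A^m maps B_{s_0} into B_s with ‖A^m u_0‖_s ≤ (m M/(s_0 − s))^m · ‖u_0‖_{s_0}. -/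
/-- A scale of Banach spaces `{B_s : 0 < s ≤ s₀}`, modelled as a family of subspaces
`carrier s` of an ambient vector space `V`, each equipped with a norm `N s` such that
`B_{s''} ⊆ B_{s'}` and `‖·‖_{s'} ≤ ‖·‖_{s''}` whenever `0 < s' ≤ s'' ≤ s₀`, and each
`(carrier s, N s)` is complete (i.e. a Banach space). -/
structure BanachScale (V : Type*) [AddCommGroup V] [Module ℝ V] (s₀ : ℝ) where
  carrier : ℝ → Set V
  N : ℝ → V → ℝ
  zero_mem : ∀ ⦃s : ℝ⦄, 0 < s → s ≤ s₀ → (0 : V) ∈ carrier s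
  add_mem : ∀ ⦃s : ℝ⦄, 0 < s → s ≤ s₀ → ∀ ⦃u v : V⦄,
    u ∈ carrier s → v ∈ carrier s → u + v ∈ carrier s
  smul_mem : ∀ ⦃s : ℝ⦄, 0 < s → s ≤ s₀ → ∀ (c : ℝ) ⦃u : V⦄,
    u ∈ carrier s → c • u ∈ carrier s
  N_nonneg : ∀ ⦃s : ℝ⦄, 0 < s → s ≤ s₀ → ∀ u : V, 0 ≤ N s u
  N_add : ∀ ⦃s : ℝ⦄, 0 < s → s ≤ s₀ → ∀ u v : V, N s (u + v) ≤ N s u + N s v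
  N_smul : ∀ ⦃s : ℝ⦄, 0 < s → s ≤ s₀ → ∀ (c : ℝ) (u : V), N s (c • u) = |c| * N s u
  eq_zero_of_N : ∀ ⦃s : ℝ⦄, 0 < s → s ≤ s₀ → ∀ u ∈ carrier s, N s u = 0 → u = 0
  antitone : ∀ ⦃s' s'' : ℝ⦄, 0 < s' → s' ≤ s'' → s'' ≤ s₀ → carrier s'' ⊆ carrier s'
  N_antitone : ∀ ⦃s' s'' : ℝ⦄, 0 < s' → s' ≤ s'' → s'' ≤ s₀ →
    ∀ u ∈ carrier s'', N s' u ≤ N s'' u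
  complete : ∀ ⦃s : ℝ⦄, 0 < s → s ≤ s₀ → ∀ f : ℕ → V, (∀ n, f n ∈ carrier s) →
    (∀ ε : ℝ, 0 < ε → ∃ K : ℕ, ∀ m n : ℕ, K ≤ m → K ≤ n → N s (f m - f n) ≤ ε) →
    ∃ u ∈ carrier s, Filter.Tendsto (fun n => N s (f n - u)) Filter.atTop (nhds 0)

/-- Each application of `A` along equally spaced indices `s₀, s₀ - d, s₀ - 2 d, …` costs a
factor `M / d`. -/
theorem iterate_estimate_of_step {V : Type*} [AddCommGroup V] [Module ℝ V] {s₀ : ℝ}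
    (S : BanachScale V s₀) (A : V → V) {M : ℝ} (hM : 0 ≤ M)
    (hA : ∀ s' s'' : ℝ, 0 < s' → s' < s'' → s'' ≤ s₀ → ∀ u ∈ S.carrier s'',
      A u ∈ S.carrier s' ∧ S.N s' (A u) ≤ M / (s'' - s') * S.N s'' u)
    {d : ℝ} (hd : 0 < d) {u : V} (hu : u ∈ S.carrier s₀) (k : ℕ) (hk : 0 < s₀ - k * d) :
    A^[k] u ∈ S.carrier (s₀ - k * d) ∧
      S.N (s₀ - k * d) (A^[k] u) ≤ (M / d) ^ k * S.N s₀ u := by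
  induction k with
  | zero => simpa using hu
  | succ k ih =>
    have hgap : s₀ - k * d - (s₀ - (k + 1 : ℕ) * d) = d := by push_cast; ring
    have hlt : s₀ - (k + 1 : ℕ) * d < s₀ - k * d := by linarith
    have hle : s₀ - k * d ≤ s₀ := sub_le_self _ (by positivity)
    obtain ⟨hmem, hbound⟩ := ih (hk.trans hlt)
    obtain ⟨hmem', hbound'⟩ := hA _ _ hk hlt hle _ hmem
    rw [Function.iterate_succ_apply']
    rw [hgap] at hbound'
    refine ⟨hmem', hbound'.trans ?_⟩
    rw [pow_succ', mul_assoc]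
    gcongr

/-- If `A` satisfies `‖A u‖_{s'} ≤ M/(s'' − s') ‖u‖_{s''}` on a scale of
Banach spaces, then for every `s ∈ (0, s₀)`, every `m ∈ ℕ` (m ≥ 1) and every
`u₀ ∈ B_{s₀}`, the `m`-fold composition `A^m` maps `B_{s₀}` into `B_s` with
`‖A^m u₀‖_s ≤ (m M/(s₀ − s))^m ‖u₀‖_{s₀}`. -/
theorem iterate_estimate_on_banach_scale
    {V : Type*} [AddCommGroup V] [Module ℝ V] {s₀ : ℝ} (hs₀ : 0 < s₀)
    (S : BanachScale V s₀) (A : V →ₗ[ℝ] V) (M : ℝ) (hM : 0 < M)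
    (hA : ∀ s' s'' : ℝ, 0 < s' → s' < s'' → s'' ≤ s₀ → ∀ u ∈ S.carrier s'',
      A u ∈ S.carrier s' ∧ S.N s' (A u) ≤ M / (s'' - s') * S.N s'' u)
    (s : ℝ) (hs : 0 < s) (hss₀ : s < s₀) (m : ℕ) (hm : 1 ≤ m)
    (u₀ : V) (hu₀ : u₀ ∈ S.carrier s₀) :
    (⇑A)^[m] u₀ ∈ S.carrier s ∧
      S.N s ((⇑A)^[m] u₀) ≤ ((m : ℝ) * M / (s₀ - s)) ^ m * S.N s₀ u₀ := by
  have hm' : (0 : ℝ) < m := by exact_mod_cast hm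
  have hd : 0 < (s₀ - s) / m := div_pos (sub_pos.2 hss₀) hm'
  have hend : s₀ - m * ((s₀ - s) / m) = s := by field_simp; ring
  have h := iterate_estimate_of_step S A hM.le hA hd hu₀ m (by rwa [hend])
  have hrate : M / ((s₀ - s) / m) = m * M / (s₀ - s) := by
    rw [div_div_eq_mul_div, mul_comm]
  rwa [hend, hrate] at h
end

section
/- Let {B_s : 0 < s ≤ s_0} be a scale of Banach spaces, and let A_ε (ε > 0) and A_0 be linear mappings such that for every pair 0 < s' < s'' ≤ s_0: (a) ‖A_ε u‖_{s'} ≤ M/(s'' − s') · ‖u‖_{s''} and ‖A_0 u‖_{s'} ≤ M/(s'' − s') · ‖u‖_{s''} for all u ∈ B_{s''}, with M > 0 independent of ε, s', s''; and (b) ‖A_ε u − A_0 u‖_{s'} ≤ Σ_{k=1}^{p} N_ε/(s'' − s')^k · ‖u‖_{s''} for some p ∈ ℕ and N_ε > 0. Then for every s ∈ (0, s_0), every m ∈ ℕ and every u_0 ∈ B_{s_0}, ‖(A_ε^m − A_0^m) u_0‖_s ≤ Σ_{k=1}^{p} (N_ε/(s_0 − s)^{k−1}) · (m M/(s_0 −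 s))^m · (m^k / M) · ‖u_0‖_{s_0}. -/
namespace BanachScale

variable {V : Type*} [AddCommGroup V] [Module ℝ V] {s₀ : ℝ} (S : BanachScale V s₀)

theorem N_zero {s : ℝ} (hs : 0 < s) (hss₀ : s ≤ s₀) : S.N s 0 = 0 := by
  simpa using S.N_smul hs hss₀ 0 0

theorem sub_mem {s : ℝ} (hs : 0 < s) (hss₀ : s ≤ s₀) {u v : V}
    (hu : u ∈ S.carrier s) (hv : v ∈ S.carrier s) : u - v ∈ S.carrier s := by
  have h := S.add_mem hs hss₀ hu (S.smul_mem hs hss₀ (-1) hv)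
  rwa [neg_one_smul, ← sub_eq_add_neg] at h

/-- Iterating a map that loses `δ` on the scale with norm at most `c`. -/
theorem iterate_mem_and_N_le {A : V → V} {δ c : ℝ} (hδ : 0 < δ) (hc : 0 ≤ c)
    (hA : ∀ s, 0 < s → s + δ ≤ s₀ → ∀ u ∈ S.carrier (s + δ),
      A u ∈ S.carrier s ∧ S.N s (A u) ≤ c * S.N (s + δ) u)
    {u : V} (hu : u ∈ S.carrier s₀) (j : ℕ) (hj : 0 < s₀ - j * δ) :
    A^[j] u ∈ S.carrier (s₀ - j * δ) ∧ S.N (s₀ - j * δ) (A^[j] u) ≤ c ^ j * S.N s₀ u := by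
  induction j with
  | zero => simpa using hu
  | succ j ih =>
    have hstep : s₀ - ((j + 1 : ℕ) : ℝ) * δ + δ = s₀ - j * δ := by push_cast; ring
    obtain ⟨hmem, hle⟩ := ih (by linarith)
    have hjδ : 0 ≤ (j : ℝ) * δ := by positivity
    have h := hA _ hj (by linarith) (A^[j] u) (hstep ▸ hmem)
    rw [hstep] at h
    rw [Function.iterate_succ_apply']
    refine ⟨h.1, h.2.trans ?_⟩
    calc c * S.N (s₀ - j * δ) (A^[j] u) ≤ c * (c ^ j * S.N s₀ u) := by gcongr
      _ = c ^ (j + 1) * S.N s₀ u := by ring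

/-- Telescoping estimate for the difference of the iterates of two maps losing `δ` on the scale,
with norms at most `c` and with difference of norm at most `e`. -/
theorem mul_N_iterate_sub_iterate_le {A B : V →ₗ[ℝ] V} {δ c e : ℝ}
    (hδ : 0 < δ) (hc : 0 ≤ c) (he : 0 ≤ e)
    (hA : ∀ s, 0 < s → s + δ ≤ s₀ → ∀ u ∈ S.carrier (s + δ),
      A u ∈ S.carrier s ∧ S.N s (A u) ≤ c * S.N (s + δ) u)
    (hB : ∀ s, 0 < s → s + δ ≤ s₀ → ∀ u ∈ S.carrier (s + δ),
      B u ∈ S.carrier s ∧ S.N s (B u) ≤ c * S.N (s + δ) u)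
    (hAB : ∀ s, 0 < s → s + δ ≤ s₀ → ∀ u ∈ S.carrier (s + δ),
      S.N s (A u - B u) ≤ e * S.N (s + δ) u)
    {u : V} (hu : u ∈ S.carrier s₀) (j : ℕ) (hj : 0 < s₀ - j * δ) :
    c * S.N (s₀ - j * δ) ((⇑A)^[j] u - (⇑B)^[j] u) ≤ j * c ^ j * e * S.N s₀ u := by
  induction j with
  | zero =>
    have hs₀ : 0 < s₀ := by simpa using hj
    simp [S.N_zero hs₀ le_rfl]
  | succ j ih =>
    have hstep : s₀ - ((j + 1 : ℕ) : ℝ) * δ + δ = s₀ - j * δ := by push_cast; ring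
    have hj' : 0 < s₀ - j * δ := by linarith
    have hjδ : 0 ≤ (j : ℝ) * δ := by positivity
    have hjs : s₀ - j * δ ≤ s₀ := by linarith
    obtain ⟨hAmem, hAle⟩ := S.iterate_mem_and_N_le hδ hc hA hu j hj'
    have hBmem := (S.iterate_mem_and_N_le hδ hc hB hu j hj').1
    have h₁ := (hB _ hj (by linarith) _ (hstep ▸ S.sub_mem hj' hjs hAmem hBmem)).2
    have h₂ := hAB _ hj (by linarith) _ (hstep ▸ hAmem)
    rw [hstep] at h₁ h₂
    have htri := S.N_add hj (by linarith) (B ((⇑A)^[j] u - (⇑B)^[j] u))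
      (A ((⇑A)^[j] u) - B ((⇑A)^[j] u))
    have hsplit : B ((⇑A)^[j] u - (⇑B)^[j] u) + (A ((⇑A)^[j] u) - B ((⇑A)^[j] u)) =
        (⇑A)^[j + 1] u - (⇑B)^[j + 1] u := by
      rw [Function.iterate_succ_apply', Function.iterate_succ_apply', map_sub]
      abel
    rw [hsplit] at htri
    calc c * S.N _ ((⇑A)^[j + 1] u - (⇑B)^[j + 1] u)
        ≤ c * (c * S.N (s₀ - j * δ) ((⇑A)^[j] u - (⇑B)^[j] u)
            + e * S.N (s₀ - j * δ) ((⇑A)^[j] u)) := by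
          gcongr
          linarith
      _ ≤ c * (j * c ^ j * e * S.N s₀ u + e * (c ^ j * S.N s₀ u)) := by
          exact mul_le_mul_of_nonneg_left (add_le_add (ih hj')
            (mul_le_mul_of_nonneg_left hAle he)) hc
      _ = ((j + 1 : ℕ) : ℝ) * c ^ (j + 1) * e * S.N s₀ u := by push_cast; ring

end BanachScale

/-- On a scale of Banach spaces, let `A_ε` and `A_0` both satisfy the
Ovsjannikov bound with constant `M`, and suppose
`‖A_ε u − A_0 u‖_{s'} ≤ Σ_{k=1}^p N_ε/(s''−s')^k ‖u‖_{s''}` for all `0 < s' < s'' ≤ s₀`.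
Then for every `s ∈ (0, s₀)`, every `m ∈ ℕ` (m ≥ 1) and every `u₀ ∈ B_{s₀}`,
`‖(A_ε^m − A_0^m) u₀‖_s ≤ Σ_{k=1}^p (N_ε/(s₀−s)^{k−1}) (m M/(s₀−s))^m (m^k/M) ‖u₀‖_{s₀}`. -/
theorem iterate_difference_estimate_on_banach_scale
    {V : Type*} [AddCommGroup V] [Module ℝ V] {s₀ : ℝ} (hs₀ : 0 < s₀)
    (S : BanachScale V s₀) (Aε A0 : V →ₗ[ℝ] V) (M : ℝ) (hM : 0 < M)
    (hAε : ∀ s' s'' : ℝ, 0 < s' → s' < s'' → s'' ≤ s₀ → ∀ u ∈ S.carrier s'',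
      Aε u ∈ S.carrier s' ∧ S.N s' (Aε u) ≤ M / (s'' - s') * S.N s'' u)
    (hA0 : ∀ s' s'' : ℝ, 0 < s' → s' < s'' → s'' ≤ s₀ → ∀ u ∈ S.carrier s'',
      A0 u ∈ S.carrier s' ∧ S.N s' (A0 u) ≤ M / (s'' - s') * S.N s'' u)
    (p : ℕ) (hp : 1 ≤ p) (Nε : ℝ) (hNε : 0 < Nε)
    (hdiff : ∀ s' s'' : ℝ, 0 < s' → s' < s'' → s'' ≤ s₀ → ∀ u ∈ S.carrier s'',
      S.N s' (Aε u - A0 u) ≤ (∑ k ∈ Finset.Icc 1 p, Nε / (s'' - s') ^ k) * S.N s'' u)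
    (s : ℝ) (hs : 0 < s) (hss₀ : s < s₀) (m : ℕ) (hm : 1 ≤ m)
    (u₀ : V) (hu₀ : u₀ ∈ S.carrier s₀) :
    (⇑Aε)^[m] u₀ ∈ S.carrier s ∧ (⇑A0)^[m] u₀ ∈ S.carrier s ∧
      S.N s ((⇑Aε)^[m] u₀ - (⇑A0)^[m] u₀) ≤
        (∑ k ∈ Finset.Icc 1 p,
          Nε / (s₀ - s) ^ (k - 1) * ((m : ℝ) * M / (s₀ - s)) ^ m * ((m : ℝ) ^ k / M)) *
          S.N s₀ u₀ := by
  have hm' : (0 : ℝ) < m := by exact_mod_cast hm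
  have hd : 0 < s₀ - s := sub_pos.2 hss₀
  obtain ⟨δ, hδ_def⟩ : ∃ δ, δ = (s₀ - s) / m := ⟨_, rfl⟩
  have hδ : 0 < δ := by rw [hδ_def]; positivity
  have hc : 0 < M / δ := by positivity
  have hend : s₀ - m * δ = s := by rw [hδ_def]; field_simp; ring
  have he : 0 ≤ ∑ k ∈ Finset.Icc 1 p, Nε / δ ^ k :=
    Finset.sum_nonneg fun k _ => by positivity
  have hA' : ∀ s, 0 < s → s + δ ≤ s₀ → ∀ u ∈ S.carrier (s + δ),
      Aε u ∈ S.carrier s ∧ S.N s (Aε u) ≤ M / δ * S.N (s + δ) u := fun s hs h u hu => by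
    simpa using hAε s (s + δ) hs (by linarith) h u hu
  have hB' : ∀ s, 0 < s → s + δ ≤ s₀ → ∀ u ∈ S.carrier (s + δ),
      A0 u ∈ S.carrier s ∧ S.N s (A0 u) ≤ M / δ * S.N (s + δ) u := fun s hs h u hu => by
    simpa using hA0 s (s + δ) hs (by linarith) h u hu
  have hAB' : ∀ s, 0 < s → s + δ ≤ s₀ → ∀ u ∈ S.carrier (s + δ),
      S.N s (Aε u - A0 u) ≤ (∑ k ∈ Finset.Icc 1 p, Nε / δ ^ k) * S.N (s + δ) u :=
    fun s hs h u hu => by simpa using hdiff s (s + δ) hs (by linarith) h u hu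
  have hpos : 0 < s₀ - m * δ := hend ▸ hs
  have h₁ := (S.iterate_mem_and_N_le hδ hc.le hA' hu₀ m hpos).1
  have h₂ := (S.iterate_mem_and_N_le hδ hc.le hB' hu₀ m hpos).1
  have h₃ := S.mul_N_iterate_sub_iterate_le hδ hc.le he hA' hB' hAB' hu₀ m hpos
  rw [hend] at h₁ h₂ h₃
  refine ⟨h₁, h₂, le_of_mul_le_mul_left (h₃.trans_eq ?_) hc⟩
  rw [← mul_assoc, Finset.mul_sum, Finset.mul_sum]
  congr 1
  refine Finset.sum_congr rfl fun k hk => ?_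
  obtain ⟨n, rfl⟩ := Nat.exists_eq_add_of_le' (Finset.mem_Icc.1 hk).1
  rw [Nat.add_sub_cancel, hδ_def, div_div_eq_mul_div, div_pow (s₀ - s), mul_comm M]
  field_simp
  ring
end
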